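/- Fix p ≥ 1, δ > 0, a horizon T with T/δ a positive integer, 0 < λmin ≤ λmax, and xmax > 0. Let Λ = [λmin, λmax]^p, Θ = [log(δλmin), log(δλmax)]^p, and for each t = 1, …, T/δ let x_t ∈ [0, δ·xmax]^p and define the loss ℓ_t(λ) = ⟨1, δλ⟩ − ⟨x_t, log(δλ)⟩ on Λ, with dual form ℓ̃_t(θ) = ⟨1, exp(θ)⟩ − ⟨x_t, θ⟩ so that ℓ̃_t(θ) = ℓ_t(exp(θ)/δ). Let D be the Bregman divergence of Z(θ) = Σ_k exp(θ_k). Let Φ_t : Λ → Λ be maps whose dual versions Φ̃_t(θ) = log(δ·Φ_t(exp(θ)/δ)) map Θ to Θ and are contractive, i.e. D(Φ̃_t(θ₁)‖Φ̃_t(θ₂)) ≤ D(θ₁‖θ₂) for all θ₁, θ₂ ∈ Θ. Fix η₀ > 0 and set η_t = η₀·√(δ/T) for all t (alternatively η_t = η₀/√t). Define iterates by θ̂₁ ∈ Θ, and for each t: θ̃_{t+1} = argmin_{θ ∈ Θ} [ η_t·⟨∇ℓ̃_t(θ̂_t), θ⟩ + D(θ‖θ̂_t) ] and θ̂_{t+1}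 = Φ̃_t(θ̃_{t+1}); set λ̂_t = exp(θ̂_t)/δ. Then there exists a constant C > 0 depending only on δ, p, xmax, λmax, λmin, and η₀ (and not on T) such that for every comparator sequence λ₁, …, λ_{T/δ + 1} ∈ Λ: Σ_{t=1}^{T/δ} ℓ_t(λ̂_t) − Σ_{t=1}^{T/δ} ℓ_t(λ_t) ≤ C·(1 + Σ_{t=1}^{T/δ} ‖λ_{t+1} − Φ_t(λ_t)‖₂)·√T. -/

import Mathlib

/-- Bregman divergence induced by the log-partition function `Z(θ) = Σ_k exp(θ_k)`. -/
noncomputable def bregD (p : ℕ) (θ₁ θ₂ : Fin p → ℝ) : ℝ :=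
  ∑ k, (Real.exp (θ₁ k) - Real.exp (θ₂ k) - Real.exp (θ₂ k) * (θ₁ k - θ₂ k))

/-- Membership in the box `[lo, hi]^p`. -/
def inBox (p : ℕ) (lo hi : ℝ) (v : Fin p → ℝ) : Prop := ∀ k, v k ∈ Set.Icc lo hi

/-- The dual version `Φ̃(θ) = log(δ·Φ(exp(θ)/δ))` (componentwise) of a dynamical
model `Φ` on rates. -/
noncomputable def dualPhi (p : ℕ) (δ : ℝ) (Φ : (Fin p → ℝ) → (Fin p → ℝ))
    (θ : Fin p → ℝ) : Fin p → ℝ :=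
  fun k => Real.log (δ * Φ (fun j => Real.exp (θ j) / δ) k)

/-- The discretized Hawkes loss `ℓ(λ) = ⟨1, δλ⟩ − ⟨x, log(δλ)⟩`. -/
noncomputable def hawkesLoss (p : ℕ) (δ : ℝ) (x lam : Fin p → ℝ) : ℝ :=
  (∑ k, δ * lam k) - ∑ k, x k * Real.log (δ * lam k)

lemma aux_sc (a x y : ℝ) (hx : a ≤ x) (hy : a ≤ y) :
    Real.exp a / 4 * (y - x) ^ 2 ≤ Real.exp y - Real.exp x - Real.exp x * (y - x) := by
  have hax : Real.exp a ≤ Real.exp x := Real.exp_le_exp.2 hx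
  have hay : Real.exp a ≤ Real.exp y := Real.exp_le_exp.2 hy
  have pa := Real.exp_pos a
  have px := Real.exp_pos x
  have py := Real.exp_pos y
  by_cases h : x - y ≤ 2
  · have h1 : (x - y) ≤ 2 := h
    have e1 : Real.exp y = Real.exp x * (Real.exp ((y - x) / 2)) ^ 2 := by
      rw [← Real.exp_nat_mul, ← Real.exp_add]; congr 1; push_cast; ring
    have e2 : 1 + (y - x) / 2 ≤ Real.exp ((y - x) / 2) := by
      linarith [Real.add_one_le_exp ((y - x) / 2)]
    have e3 : (1 + (y - x) / 2) ^ 2 ≤ Real.exp ((y - x) / 2) ^ 2 :=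
      pow_le_pow_left₀ (by linarith) e2 2
    have e4 : Real.exp x * (1 + (y - x) / 2) ^ 2 ≤ Real.exp y := by
      rw [e1]; exact mul_le_mul_of_nonneg_left e3 px.le
    have e5 : Real.exp a * (y - x) ^ 2 ≤ Real.exp x * (y - x) ^ 2 :=
      mul_le_mul_of_nonneg_right hax (sq_nonneg _)
    nlinarith
  · push Not at h
    have e1 : Real.exp x = Real.exp y * Real.exp (x - y) := by
      rw [← Real.exp_add]; congr 1; ring
    have e2 : 1 + (x - y) ≤ Real.exp (x - y) := by linarith [Real.add_one_le_exp (x - y)]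
    have e3 : Real.exp y * (1 + (x - y)) ≤ Real.exp x := by
      rw [e1]; exact mul_le_mul_of_nonneg_left e2 py.le
    have e4 : Real.exp y * (1 + (x - y)) * (x - y - 1) ≤ Real.exp x * (x - y - 1) :=
      mul_le_mul_of_nonneg_right e3 (by linarith)
    have e5 : Real.exp a * (y - x) ^ 2 ≤ Real.exp y * (y - x) ^ 2 :=
      mul_le_mul_of_nonneg_right hay (sq_nonneg _)
    nlinarith [mul_nonneg py.le (sq_nonneg (y - x))]

lemma aux_nonneg (p : ℕ) (u v : Fin p → ℝ) : 0 ≤ bregD p u v := by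
  unfold bregD
  apply Finset.sum_nonneg
  intro k _
  have e1 : Real.exp (u k) = Real.exp (v k) * Real.exp (u k - v k) := by
    rw [← Real.exp_add]; congr 1; ring
  have e2 := Real.add_one_le_exp (u k - v k)
  have := mul_le_mul_of_nonneg_left e2 (Real.exp_pos (v k)).le
  linarith

lemma aux_opt (p : ℕ) (a b η : ℝ) (g h w u : Fin p → ℝ)
    (hw : inBox p a b w) (hu : inBox p a b u)
    (hopt : ∀ θ, inBox p a b θ →
      η * (∑ k, g k * w k) + bregD p w h ≤ η * (∑ k, g k * θ k) + bregD p θ h) :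
    0 ≤ ∑ k, (u k - w k) * (η * g k - Real.exp (h k) + Real.exp (w k)) := by
  have key : ∀ s ∈ Set.Ioc (0 : ℝ) 1, 0 ≤ ∑ k, (u k - w k) *
      (η * g k - Real.exp (h k) + Real.exp (w k + s * (u k - w k))) := by
    rintro s ⟨hs0, hs1⟩
    have h1 := hopt (fun k => w k + s * (u k - w k)) (by
      intro k
      obtain ⟨h1, h2⟩ := hw k
      obtain ⟨h3, h4⟩ := hu k
      constructor
      · change a ≤ w k + s * (u k - w k)
        nlinarith [mul_nonneg hs0.le (sub_nonneg.2 h3),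
          mul_nonneg (sub_nonneg.2 hs1) (sub_nonneg.2 h1)]
      · change w k + s * (u k - w k) ≤ b
        nlinarith [mul_nonneg hs0.le (sub_nonneg.2 h4),
          mul_nonneg (sub_nonneg.2 hs1) (sub_nonneg.2 h2)])
    have h2 : 0 ≤ s * ∑ k, (u k - w k) *
      (η * g k - Real.exp (h k) + Real.exp (w k + s * (u k - w k))) := by
      unfold bregD at h1
      rw [Finset.mul_sum, Finset.mul_sum, ← Finset.sum_add_distrib,
        ← Finset.sum_add_distrib, ← sub_nonneg, ← Finset.sum_sub_distrib] at h1
      refine h1.trans ?_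
      rw [Finset.mul_sum]
      apply Finset.sum_le_sum
      intro k _
      have e1 : Real.exp (w k) = Real.exp (w k + s * (u k - w k)) *
          Real.exp (-(s * (u k - w k))) := by
        rw [← Real.exp_add]; congr 1; ring
      have e2 := Real.add_one_le_exp (-(s * (u k - w k)))
      have := mul_le_mul_of_nonneg_left e2 (Real.exp_pos (w k + s * (u k - w k))).le
      rw [← e1] at this
      dsimp only
      linarith
    exact nonneg_of_mul_nonneg_right h2 hs0
  have hc : Continuous (fun s : ℝ => ∑ k, (u k - w k) *
      (η * g k - Real.exp (h k) + Real.exp (w k + s * (u k - w k)))) := by fun_prop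
  have ht := (hc.tendsto 0).mono_left (nhdsWithin_le_nhds (s := Set.Ioi 0))
  simp only [zero_mul, add_zero] at ht
  refine ge_of_tendsto ht ?_
  filter_upwards [Ioc_mem_nhdsGT (zero_lt_one (α := ℝ))] with s hs using key s hs

lemma aux_step (p : ℕ) (a b G η : ℝ) (hη : 0 < η) (x h w u : Fin p → ℝ)
    (hh : inBox p a b h) (hw : inBox p a b w) (hu : inBox p a b u)
    (hG : ∀ k, (Real.exp (h k) - x k) ^ 2 ≤ G)
    (hopt : ∀ θ, inBox p a b θ →
      η * (∑ k, (Real.exp (h k) - x k) * w k) + bregD p w h ≤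
        η * (∑ k, (Real.exp (h k) - x k) * θ k) + bregD p θ h) :
    (∑ k, (Real.exp (h k) - x k * h k)) - (∑ k, (Real.exp (u k) - x k * u k)) ≤
      1 / η * (bregD p u h - bregD p u w) + η * (p * G / Real.exp a) := by
  have h1 := aux_opt p a b η _ h w u hw hu hopt
  have pa := Real.exp_pos a
  suffices hs : η * ((∑ k, (Real.exp (h k) - x k * h k)) - (∑ k, (Real.exp (u k) - x k * u k)))
      ≤ (bregD p u h - bregD p u w) + η * (η * (p * G / Real.exp a)) by
    have := mul_le_mul_of_nonneg_left hs (one_div_pos.2 hη).le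
    have e1 : 1 / η * η = 1 := by field_simp
    rw [← mul_assoc, e1, one_mul, mul_add, ← mul_assoc (1 / η) η, e1, one_mul] at this
    exact this
  have e0 : η * (η * (p * G / Real.exp a)) = ∑ k : Fin p, η * (η * (G / Real.exp a)) := by
    rw [Finset.sum_const, Finset.card_univ, Fintype.card_fin, nsmul_eq_mul]; ring
  rw [e0]
  unfold bregD
  rw [← Finset.sum_sub_distrib, ← Finset.sum_sub_distrib, Finset.mul_sum,
    ← Finset.sum_add_distrib, ← sub_nonneg, ← Finset.sum_sub_distrib]
  refine h1.trans (Finset.sum_le_sum fun k _ => ?_)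
  have s1 := aux_sc a (h k) (w k) (hh k).1 (hw k).1
  have s2 : Real.exp (h k) * (u k - h k) ≤ Real.exp (u k) - Real.exp (h k) := by
    have e1 : Real.exp (u k) = Real.exp (h k) * Real.exp (u k - h k) := by
      rw [← Real.exp_add]; congr 1; ring
    have := mul_le_mul_of_nonneg_left (Real.add_one_le_exp (u k - h k)) (Real.exp_pos (h k)).le
    linarith
  have s2' := mul_le_mul_of_nonneg_left s2 hη.le
  have s3 : η * ((Real.exp (h k) - x k) * (h k - w k)) ≤
      Real.exp a / 4 * (w k - h k) ^ 2 + η * (η * (G / Real.exp a)) := by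
    have t1 : η * (η * ((Real.exp (h k) - x k) ^ 2 / Real.exp a)) ≤
        η * (η * (G / Real.exp a)) := by gcongr; exact hG k
    have t2 : 0 ≤ Real.exp a / 4 * (w k - h k) ^ 2 +
        η * (η * ((Real.exp (h k) - x k) ^ 2 / Real.exp a)) -
        η * ((Real.exp (h k) - x k) * (h k - w k)) := by
      have : Real.exp a / 4 * (w k - h k) ^ 2 +
        η * (η * ((Real.exp (h k) - x k) ^ 2 / Real.exp a)) -
        η * ((Real.exp (h k) - x k) * (h k - w k)) =
        (Real.exp a / 2 * (h k - w k) - η * (Real.exp (h k) - x k)) ^ 2 / Real.exp a := by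
        field_simp; ring
      rw [this]; positivity
    linarith
  nlinarith

lemma aux_tel (c A : ℕ → ℝ) (R : ℝ) (hc1 : 0 ≤ c 1) (hc : ∀ t, 1 ≤ t → c t ≤ c (t + 1))
    (hR : ∀ t, A t ≤ R) (M : ℕ) (hM : 1 ≤ M) :
    ∑ t ∈ Finset.Icc 1 M, c t * (A t - A (t + 1)) ≤ c M * (R - A (M + 1)) := by
  induction M, hM using Nat.le_induction with
  | base => simp; exact mul_le_mul_of_nonneg_left (by linarith [hR 1]) hc1
  | succ n hn ih =>
    rw [Finset.sum_Icc_succ_top (by omega)]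
    nlinarith [mul_le_mul_of_nonneg_right (hc n hn) (sub_nonneg.2 (hR (n + 1)))]

lemma aux_sqrt (M : ℕ) : ∑ t ∈ Finset.Icc 1 M, 1 / Real.sqrt t ≤ 2 * Real.sqrt M := by
  induction M with
  | zero => simp
  | succ n ih =>
    rw [Finset.sum_Icc_succ_top (by omega)]
    have h1 : 0 < Real.sqrt ((n + 1 : ℕ) : ℝ) := Real.sqrt_pos.2 (by positivity)
    have h2 := Real.sq_sqrt (show (0:ℝ) ≤ ((n + 1 : ℕ) : ℝ) by positivity)
    have h3 := Real.sq_sqrt (show (0:ℝ) ≤ (n : ℝ) by positivity)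
    have : 1 / Real.sqrt ((n + 1 : ℕ) : ℝ) ≤ 2 * Real.sqrt ((n + 1 : ℕ) : ℝ) - 2 * Real.sqrt n := by
      rw [div_le_iff₀ h1]
      have e : ((n + 1 : ℕ) : ℝ) = n + 1 := by push_cast; ring
      nlinarith [sq_nonneg (Real.sqrt ((n + 1 : ℕ) : ℝ) - Real.sqrt n)]
    linarith

lemma aux_eta (η₀ δ T : ℝ) (hη₀ : 0 < η₀) (hδ : 0 < δ) (M : ℕ) (hM : 0 < M) (hT : T = M * δ)
    (η : ℕ → ℝ)
    (h : (∀ t, η t = η₀ * Real.sqrt (δ / T)) ∨ (∀ t : ℕ, η t = η₀ / Real.sqrt t)) :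
    (∀ t, 1 ≤ t → 0 < η t) ∧ (∀ t, 1 ≤ t → 1 / η t ≤ 1 / η (t + 1)) ∧
    (∀ t, 1 ≤ t → t ≤ M → 1 / η t ≤ Real.sqrt M / η₀) ∧
    ∑ t ∈ Finset.Icc 1 M, η t ≤ 2 * η₀ * Real.sqrt M := by
  have hM' : (0 : ℝ) < M := by exact_mod_cast hM
  have hs : 0 < Real.sqrt M := Real.sqrt_pos.2 hM'
  rcases h with h | h
  · have e : ∀ t, η t = η₀ / Real.sqrt M := by
      intro t
      rw [h t, hT, show δ / (M * δ) = (M : ℝ)⁻¹ by field_simp, Real.sqrt_inv, div_eq_mul_inv]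
    refine ⟨fun t _ => by rw [e]; positivity, fun t _ => by rw [e, e],
      fun t _ _ => by rw [e, one_div_div], ?_⟩
    simp only [e, Finset.sum_const, Nat.card_Icc, nsmul_eq_mul, Nat.add_sub_cancel]
    have := Real.mul_self_sqrt hM'.le
    have e2 : (M : ℝ) * (η₀ / Real.sqrt M) = η₀ * Real.sqrt M := by
      field_simp; nlinarith
    rw [e2]; nlinarith [mul_pos hη₀ hs]
  · have hp : ∀ t : ℕ, 1 ≤ t → 0 < Real.sqrt t := fun t ht =>
      Real.sqrt_pos.2 (by exact_mod_cast ht)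
    refine ⟨fun t ht => by rw [h]; exact div_pos hη₀ (hp t ht), fun t _ => ?_, fun t _ htM => ?_, ?_⟩
    · rw [h, h, one_div_div, one_div_div]; gcongr; simp
    · rw [h, one_div_div]; gcongr
    · have := mul_le_mul_of_nonneg_left (aux_sqrt M) hη₀.le
      rw [Finset.mul_sum] at this
      calc _ = ∑ t ∈ Finset.Icc 1 M, η₀ * (1 / Real.sqrt t) :=
            Finset.sum_congr rfl fun t _ => by rw [h]; ring
        _ ≤ _ := this
        _ = _ := by ring

lemma aux_lip (p : ℕ) (δ m B : ℝ) (hδ : 0 < δ) (hm : 0 < m) (l l' w : Fin p → ℝ)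
    (hl : ∀ k, m ≤ l k) (hl' : ∀ k, m ≤ l' k) (hw : ∀ k, Real.exp (w k) ≤ B) (hB : 0 ≤ B) :
    bregD p (fun k => Real.log (δ * l k)) w - bregD p (fun k => Real.log (δ * l' k)) w ≤
      p * (δ + B / m) * Real.sqrt (∑ k, (l k - l' k) ^ 2) := by
  have key : ∀ y z : ℝ, m ≤ y → m ≤ z → Real.log (δ * y) - Real.log (δ * z) ≤ |y - z| / m := by
    intro y z hy hz
    have py : 0 < y := by linarith
    have pz : 0 < z := by linarith
    rw [Real.log_mul hδ.ne' py.ne', Real.log_mul hδ.ne' pz.ne', add_sub_add_left_eq_sub,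
      ← Real.log_div py.ne' pz.ne']
    have h1 := Real.log_le_sub_one_of_pos (div_pos py pz)
    have h2 : y / z - 1 = (y - z) / z := by field_simp
    have h3 : (y - z) / z ≤ |y - z| / z := by gcongr; exact le_abs_self _
    have h4 : |y - z| / z ≤ |y - z| / m := by gcongr
    linarith
  unfold bregD
  rw [← Finset.sum_sub_distrib]
  have : p * (δ + B / m) * Real.sqrt (∑ k, (l k - l' k) ^ 2) =
    ∑ k : Fin p, (δ + B / m) * Real.sqrt (∑ k, (l k - l' k) ^ 2) := by
    rw [Finset.sum_const, Finset.card_univ, Fintype.card_fin, nsmul_eq_mul]; ring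
  rw [this]
  apply Finset.sum_le_sum
  intro k _
  have p1 : 0 < δ * l k := mul_pos hδ (by linarith [hl k])
  have p2 : 0 < δ * l' k := mul_pos hδ (by linarith [hl' k])
  simp only [Real.exp_log p1, Real.exp_log p2]
  have a1 : |l k - l' k| ≤ Real.sqrt (∑ k, (l k - l' k) ^ 2) := by
    rw [← Real.sqrt_sq_eq_abs]
    apply Real.sqrt_le_sqrt
    exact Finset.single_le_sum (f := fun k => (l k - l' k) ^ 2) (fun i _ => sq_nonneg _)
      (Finset.mem_univ k)
  have a2 := key (l' k) (l k) (hl' k) (hl k)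
  have a3 : Real.exp (w k) * (Real.log (δ * l' k) - Real.log (δ * l k)) ≤ B * (|l' k - l k| / m) :=
    (mul_le_mul_of_nonneg_left a2 (Real.exp_pos _).le).trans
      (mul_le_mul_of_nonneg_right (hw k) (by positivity))
  rw [abs_sub_comm] at a3
  have a4 : δ * (l k - l' k) ≤ δ * |l k - l' k| := by gcongr; exact le_abs_self _
  have a5 : (δ + B / m) * |l k - l' k| ≤ (δ + B / m) * Real.sqrt (∑ k, (l k - l' k) ^ 2) := by
    gcongr
  have a6 : (δ + B / m) * |l k - l' k| = δ * |l k - l' k| + B * (|l k - l' k| / m) := by ring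
  linarith

/-- Theorem 1 of the paper (tracking regret of Algorithm 1 / Dynamic Mirror Descent
for multivariate Hawkes tracking with known network).  There is a constant `C > 0`
depending only on `δ, p, xmax, λmax, λmin, η₀` (not on `T`) such that: for any horizon
`T = M·δ`, data `x_t ∈ [0, δ·xmax]^p`, contractive dynamical models `Φ_t : Λ → Λ`
(contractive in the dual Bregman divergence), step sizes `η_t = η₀·√(δ/T)` (or
`η₀/√t`), and iterates `θ̃_{t+1} = argmin_{θ∈Θ} η_t⟨∇ℓ̃_t(θ̂_t), θ⟩ + D(θ‖θ̂_t)`,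
`θ̂_{t+1} = Φ̃_t(θ̃_{t+1})`, `λ̂_t = exp(θ̂_t)/δ`, the regret against any comparator
sequence `λ_1, …, λ_{T/δ+1} ∈ Λ` satisfies
`Σ_t ℓ_t(λ̂_t) − Σ_t ℓ_t(λ_t) ≤ C·(1 + Σ_t ‖λ_{t+1} − Φ_t(λ_t)‖₂)·√T`. -/
theorem stmt_18 (p : ℕ) (hp : 1 ≤ p) (δ lammin lammax xmax η₀ : ℝ)
    (hδ : 0 < δ) (hmin : 0 < lammin) (hle : lammin ≤ lammax)
    (hxmax : 0 < xmax) (hη₀ : 0 < η₀) :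
    ∃ C > 0, ∀ (M : ℕ), 0 < M → ∀ T : ℝ, T = M * δ →
      ∀ x : ℕ → Fin p → ℝ, (∀ t k, x t k ∈ Set.Icc (0 : ℝ) (δ * xmax)) →
      ∀ Φ : ℕ → (Fin p → ℝ) → (Fin p → ℝ),
        (∀ t lam, inBox p lammin lammax lam → inBox p lammin lammax (Φ t lam)) →
        (∀ t θ₁ θ₂, inBox p (Real.log (δ * lammin)) (Real.log (δ * lammax)) θ₁ →
          inBox p (Real.log (δ * lammin)) (Real.log (δ * lammax)) θ₂ →
          bregD p (dualPhi p δ (Φ t) θ₁) (dualPhi p δ (Φ t) θ₂) ≤ bregD p θ₁ θ₂) →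
      ∀ η : ℕ → ℝ,
        ((∀ t, η t = η₀ * Real.sqrt (δ / T)) ∨ (∀ t, η t = η₀ / Real.sqrt t)) →
      ∀ θhat θtil : ℕ → Fin p → ℝ,
        (∀ t, inBox p (Real.log (δ * lammin)) (Real.log (δ * lammax)) (θhat t)) →
        (∀ t, 1 ≤ t →
          inBox p (Real.log (δ * lammin)) (Real.log (δ * lammax)) (θtil (t + 1)) ∧
          ∀ θ : Fin p → ℝ,
            inBox p (Real.log (δ * lammin)) (Real.log (δ * lammax)) θ →
            η t * (∑ k, (Real.exp (θhat t k) - x t k) * θtil (t + 1) k) +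
                bregD p (θtil (t + 1)) (θhat t) ≤
              η t * (∑ k, (Real.exp (θhat t k) - x t k) * θ k) +
                bregD p θ (θhat t)) →
        (∀ t, 1 ≤ t → θhat (t + 1) = dualPhi p δ (Φ t) (θtil (t + 1))) →
      ∀ lam : ℕ → Fin p → ℝ, (∀ t, inBox p lammin lammax (lam t)) →
        (∑ t ∈ Finset.Icc 1 M,
            hawkesLoss p δ (x t) (fun k => Real.exp (θhat t k) / δ)) -
          (∑ t ∈ Finset.Icc 1 M, hawkesLoss p δ (x t) (lam t)) ≤
        C * (1 + ∑ t ∈ Finset.Icc 1 M,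
            Real.sqrt (∑ k, (lam (t + 1) k - Φ t (lam t) k) ^ 2)) * Real.sqrt T := by
  set a := Real.log (δ * lammin) with ha
  set b := Real.log (δ * lammax) with hb
  have hmax : 0 < lammax := lt_of_lt_of_le hmin hle
  have ea : Real.exp a = δ * lammin := Real.exp_log (by positivity)
  have eb : Real.exp b = δ * lammax := Real.exp_log (by positivity)
  have hab : a ≤ b := Real.log_le_log (by positivity) (by gcongr)
  set B := δ * lammax with hB
  have pB : 0 < B := by positivity
  set G := (B + δ * xmax) ^ 2 with hG
  set R := p * (B + B * (b - a)) with hR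
  set L := p * (δ + B / lammin) with hL
  set K := p * G / Real.exp a with hK
  have pR : 0 ≤ R := by
    have : 0 ≤ b - a := by linarith
    positivity
  have pL : 0 ≤ L := by positivity
  have pK : 0 ≤ K := by positivity
  have sδ : 0 < Real.sqrt δ := Real.sqrt_pos.2 hδ
  refine ⟨(R / η₀ + L / η₀ + K * (2 * η₀) + 1) / Real.sqrt δ, by positivity, ?_⟩
  intro M hM T hT x hx Φ hΦ hcontr η hη θhat θtil hhat htil hstep lam hlam
  obtain ⟨η1, η2, η3, η4⟩ := aux_eta η₀ δ T hη₀ hδ M hM hT η hη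
  set u : ℕ → Fin p → ℝ := fun t k => Real.log (δ * lam t k) with hu
  have toBox : ∀ l : Fin p → ℝ, inBox p lammin lammax l →
      inBox p a b (fun k => Real.log (δ * l k)) := by
    intro l hl k
    have h1 := (hl k).1
    have h2 := (hl k).2
    have h3 : 0 < l k := by linarith
    exact ⟨Real.log_le_log (by positivity) (by gcongr),
      Real.log_le_log (by positivity) (by gcongr)⟩
  have hubox : ∀ t, inBox p a b (u t) := fun t => toBox _ (hlam t)
  have hexpu : ∀ t k, Real.exp (u t k) = δ * lam t k := fun t k =>
    Real.exp_log (mul_pos hδ (by linarith [(hlam t k).1]))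
  have hexple : ∀ w, inBox p a b w → ∀ k, Real.exp (w k) ≤ B := fun w hw k => by
    rw [← eb]; exact Real.exp_le_exp.2 (hw k).2
  have hdual : ∀ t, dualPhi p δ (Φ t) (u t) = fun k => Real.log (δ * Φ t (lam t) k) := by
    intro t
    unfold dualPhi
    have : (fun j => Real.exp (u t j) / δ) = lam t := by
      funext j; rw [hexpu]; field_simp
    rw [this]
  set A : ℕ → ℝ := fun t => bregD p (u t) (θhat t) with hA
  have hAR : ∀ t, A t ≤ R := by
    intro t
    have : R = ∑ k : Fin p, (B + B * (b - a)) := by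
      rw [Finset.sum_const, Finset.card_univ, Fintype.card_fin, nsmul_eq_mul]
    rw [this]
    apply Finset.sum_le_sum
    intro k _
    have h1 := hexple _ (hubox t) k
    have h2 := hexple _ (hhat t) k
    have h3 : Real.exp (θhat t k) * (θhat t k - u t k) ≤ B * (b - a) :=
      (mul_le_mul_of_nonneg_left (by linarith [(hubox t k).1, (hhat t k).2])
        (Real.exp_pos _).le).trans (mul_le_mul_of_nonneg_right h2 (by linarith))
    linarith [Real.exp_pos (θhat t k)]
  set V : ℕ → ℝ := fun t => Real.sqrt (∑ k, (lam (t + 1) k - Φ t (lam t) k) ^ 2) with hV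
  have hV0 : ∀ t, 0 ≤ V t := fun t => Real.sqrt_nonneg _
  have main : ∀ t ∈ Finset.Icc 1 M,
      hawkesLoss p δ (x t) (fun k => Real.exp (θhat t k) / δ) - hawkesLoss p δ (x t) (lam t) ≤
      1 / η t * (A t - A (t + 1)) + Real.sqrt M / η₀ * (L * V t) + η t * K := by
    intro t ht
    obtain ⟨ht1, htM⟩ := Finset.mem_Icc.1 ht
    obtain ⟨hw, hopt⟩ := htil t ht1
    have h1 := aux_step p a b G (η t) (η1 t ht1) (x t) (θhat t) (θtil (t + 1)) (u t)
      (hhat t) hw (hubox t) (by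
        intro k
        have := hexple _ (hhat t) k
        have := Real.exp_pos (θhat t k)
        have := (hx t k).1
        have := (hx t k).2
        exact sq_le_sq' (by linarith) (by linarith)) hopt
    have l1 : hawkesLoss p δ (x t) (fun k => Real.exp (θhat t k) / δ) =
        ∑ k, (Real.exp (θhat t k) - x t k * θhat t k) := by
      unfold hawkesLoss
      rw [← Finset.sum_sub_distrib]
      refine Finset.sum_congr rfl fun k _ => ?_
      rw [mul_div_cancel₀ _ hδ.ne', Real.log_exp]
    have l2 : hawkesLoss p δ (x t) (lam t) = ∑ k, (Real.exp (u t k) - x t k * u t k) := by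
      unfold hawkesLoss
      rw [← Finset.sum_sub_distrib]
      refine Finset.sum_congr rfl fun k _ => ?_
      rw [hexpu]
    rw [l1, l2]
    have h2 := hcontr t (u t) (θtil (t + 1)) (hubox t) hw
    rw [← hstep t ht1, hdual] at h2
    have h3 := aux_lip p δ lammin B hδ hmin (lam (t + 1)) (Φ t (lam t)) (θhat (t + 1))
      (fun k => (hlam (t + 1) k).1) (fun k => (hΦ t _ (hlam t) k).1) (hexple _ (hhat (t + 1))) pB.le
    have h4 : bregD p (u t) (θhat t) - bregD p (u t) (θtil (t + 1)) ≤
        (A t - A (t + 1)) + L * V t := by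
      simp only [hA, hu, hL, hV] at *
      linarith
    have h5 : 1 / η t * (bregD p (u t) (θhat t) - bregD p (u t) (θtil (t + 1))) ≤
        1 / η t * ((A t - A (t + 1)) + L * V t) :=
      mul_le_mul_of_nonneg_left h4 (one_div_pos.2 (η1 t ht1)).le
    have h6 : 1 / η t * (L * V t) ≤ Real.sqrt M / η₀ * (L * V t) :=
      mul_le_mul_of_nonneg_right (η3 t ht1 htM) (mul_nonneg pL (hV0 t))
    linarith
  have hsum := Finset.sum_le_sum main
  rw [Finset.sum_sub_distrib, Finset.sum_add_distrib, Finset.sum_add_distrib,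
    ← Finset.mul_sum, ← Finset.mul_sum, ← Finset.sum_mul] at hsum
  have htel := aux_tel (fun t => 1 / η t) A R (one_div_pos.2 (η1 1 le_rfl)).le η2 hAR M hM
  have hlast : 1 / η M * (R - A (M + 1)) ≤ Real.sqrt M / η₀ * R :=
    (mul_le_mul_of_nonneg_left (by linarith [aux_nonneg p (u (M + 1)) (θhat (M + 1))])
      (one_div_pos.2 (η1 M hM)).le).trans
      (mul_le_mul_of_nonneg_right (η3 M hM le_rfl) pR)
  have hη' := mul_le_mul_of_nonneg_right η4 pK
  have hS : 0 ≤ ∑ t ∈ Finset.Icc 1 M, V t := Finset.sum_nonneg fun t _ => hV0 t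
  set S := ∑ t ∈ Finset.Icc 1 M, V t with hSdef
  have hTs : Real.sqrt T = Real.sqrt M * Real.sqrt δ := by
    rw [hT, Real.sqrt_mul (by positivity)]
  rw [hTs]
  have efin : (R / η₀ + L / η₀ + K * (2 * η₀) + 1) / Real.sqrt δ * (1 + S) *
      (Real.sqrt M * Real.sqrt δ) =
      (R / η₀ + L / η₀ + K * (2 * η₀) + 1) * (1 + S) * Real.sqrt M := by
    field_simp
  rw [efin]
  have f1 : 0 ≤ (R / η₀ * S + L / η₀ + K * (2 * η₀) * S + 1 + S) * Real.sqrt M := by positivity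
  have f2 : (R / η₀ + L / η₀ + K * (2 * η₀) + 1) * (1 + S) * Real.sqrt M =
    (R / η₀ * S + L / η₀ + K * (2 * η₀) * S + 1 + S) * Real.sqrt M +
     (Real.sqrt M / η₀ * R + Real.sqrt M / η₀ * (L * S) + 2 * η₀ * Real.sqrt M * K) := by ring
  rw [f2]
  linarith
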